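/- arXiv:2411.03517 — 2 statements merged into one kernel-verified Lean document; each statement's English description precedes it below -/
import Mathlib

section
/- Let F be a SharedGMM on ℝ^d parameterized by {w_k, μ_k, Σ}_{k∈[K]}, and let A_F ∈ ℝ^{d×m} be a full-column-rank matrix whose column space equals the Fisher subspace S_F = Span{Σ^{-1}μ_k : k∈[K]}. Let φ(·; μ, C) denote the Gaussian density with mean μ and covariance C. Then for every x ∈ ℝ^d and every k ∈ [K], the class posterior is preserved under projection by A_F: w_k φ(x; μ_k, Σ) / (Σ_{j∈[K]} w_j φ(x; μ_j, Σ)) = w_k φ(A_Fᵀx; A_Fᵀμ_k, A_FᵀΣA_F) / (Σ_{j∈[K]} w_j φ(A_Fᵀx; A_Fᵀμ_j, A_FᵀΣA_F)). -/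
open Matrix Real

noncomputable section

/-- The Gaussian density `φ(y; μ, C)` on `ℝ^n`. -/
def gaussDensity {n : Type*} [Fintype n] [DecidableEq n]
    (μ : n → ℝ) (C : Matrix n n ℝ) (y : n → ℝ) : ℝ :=
  (2 * Real.pi) ^ (-(Fintype.card n : ℝ) / 2) * C.det ^ (-(1 : ℝ) / 2) *
    Real.exp (-((y - μ) ⬝ᵥ C⁻¹.mulVec (y - μ)) / 2)

end

theorem gaussDensity_pos {n : Type*} [Fintype n] [DecidableEq n] {C : Matrix n n ℝ}
    (hC : C.PosDef) (μ y : n → ℝ) : 0 < gaussDensity μ C y := by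
  have := hC.det_pos
  unfold gaussDensity
  positivity

/-- Exponential tilting: a Gaussian density with mean `C v` is the centred one times
`exp (⟨y, v⟩ - ⟨v, C v⟩ / 2)`. -/
theorem gaussDensity_mulVec {n : Type*} [Fintype n] [DecidableEq n] {C : Matrix n n ℝ}
    (hC : C.PosDef) (v y : n → ℝ) :
    gaussDensity (C *ᵥ v) C y =
      gaussDensity 0 C y * Real.exp (y ⬝ᵥ v - v ⬝ᵥ C *ᵥ v / 2) := by
  have hdet : IsUnit C.det := hC.det_pos.ne'.isUnit
  have hT : Cᵀ = C := by simpa using hC.isHermitian.eq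
  have hinv : C⁻¹ *ᵥ C *ᵥ v = v := by
    rw [mulVec_mulVec, nonsing_inv_mul _ hdet, one_mulVec]
  have hcross : (C *ᵥ v) ⬝ᵥ C⁻¹ *ᵥ y = y ⬝ᵥ v := by
    rw [dotProduct_mulVec, ← mulVec_transpose, transpose_nonsing_inv, hT, hinv,
      dotProduct_comm]
  have hquad : (y - C *ᵥ v) ⬝ᵥ C⁻¹ *ᵥ (y - C *ᵥ v) =
      y ⬝ᵥ C⁻¹ *ᵥ y - 2 * (y ⬝ᵥ v) + v ⬝ᵥ C *ᵥ v := by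
    rw [mulVec_sub, hinv, sub_dotProduct, dotProduct_sub, dotProduct_sub, hcross,
      dotProduct_comm (C *ᵥ v) v]
    ring
  unfold gaussDensity
  rw [hquad, sub_zero, mul_assoc _ (Real.exp _), ← Real.exp_add]
  congr 2
  ring

/-- For a SharedGMM and a full-column-rank matrix `A_F` whose column space
equals the Fisher subspace `Span{Σ⁻¹μ_k}`, the class posterior probabilities are preserved
under the projection `x ↦ A_Fᵀx`. -/
theorem fisher_projection_preserves_posterior
    {d m K : ℕ}
    (w : Fin K → ℝ) (μ : Fin K → Fin d → ℝ) (S : Matrix (Fin d) (Fin d) ℝ)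
    (hw : ∀ k, 0 < w k) (hw1 : ∑ k, w k = 1) (hS : S.PosDef)
    (AF : Matrix (Fin d) (Fin m) ℝ)
    (hrank : Function.Injective AF.mulVecLin)
    (hcol : LinearMap.range AF.mulVecLin =
      Submodule.span ℝ (Set.range fun k => S⁻¹.mulVec (μ k))) :
    ∀ (x : Fin d → ℝ) (k : Fin K),
      w k * gaussDensity (μ k) S x / (∑ j, w j * gaussDensity (μ j) S x) =
        w k * gaussDensity (AFᵀ.mulVec (μ k)) (AFᵀ * S * AF) (AFᵀ.mulVec x) /
          (∑ j, w j * gaussDensity (AFᵀ.mulVec (μ j)) (AFᵀ * S * AF) (AFᵀ.mulVec x)) := by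
  intro x k
  have hC : (AFᵀ * S * AF).PosDef := by
    simpa using hS.conjTranspose_mul_mul_same hrank
  have hdet : IsUnit S.det := hS.det_pos.ne'.isUnit
  have hb : ∀ j, ∃ b, AF *ᵥ b = S⁻¹ *ᵥ μ j := fun j => by
    have hmem : S⁻¹ *ᵥ μ j ∈ LinearMap.range AF.mulVecLin :=
      hcol ▸ Submodule.subset_span ⟨j, rfl⟩
    exact hmem
  choose b hb using hb
  have hμ : ∀ j, μ j = S *ᵥ AF *ᵥ b j := fun j => by
    rw [hb, mulVec_mulVec, mul_nonsing_inv _ hdet, one_mulVec]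
  have hprojMean : ∀ j, AFᵀ *ᵥ μ j = (AFᵀ * S * AF) *ᵥ b j := fun j => by
    rw [hμ, mulVec_mulVec, mulVec_mulVec, Matrix.mul_assoc]
  have hdot : ∀ (z : Fin d → ℝ) j, (AFᵀ *ᵥ z) ⬝ᵥ b j = z ⬝ᵥ AF *ᵥ b j := fun z j => by
    rw [mulVec_transpose, dotProduct_mulVec]
  have hratio : ∀ j, gaussDensity (μ j) S x =
      gaussDensity 0 S x / gaussDensity 0 (AFᵀ * S * AF) (AFᵀ *ᵥ x) *
        gaussDensity (AFᵀ *ᵥ μ j) (AFᵀ * S * AF) (AFᵀ *ᵥ x) := fun j => by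
    have hquad : b j ⬝ᵥ (AFᵀ * S * AF) *ᵥ b j = (AF *ᵥ b j) ⬝ᵥ S *ᵥ AF *ᵥ b j := by
      rw [← hprojMean, dotProduct_comm, hdot, dotProduct_comm, ← hμ]
    have hne := (gaussDensity_pos hC 0 (AFᵀ *ᵥ x)).ne'
    rw [hprojMean, gaussDensity_mulVec hC, hμ, gaussDensity_mulVec hS, hdot, hquad]
    field_simp
  have hne := (div_pos (gaussDensity_pos hS 0 x)
    (gaussDensity_pos hC 0 (AFᵀ *ᵥ x))).ne'
  simp_rw [hratio, mul_left_comm (w _)]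
  rw [← Finset.mul_sum, mul_div_mul_left _ _ hne]
end

section
/- Let {w_k, μ_k, Σ}_{k∈[K]} be the parameters of a SharedGMM on ℝ^d and define the Fisher discriminant J(A) = Tr([AᵀΣA]^{-1}[Aᵀ(Σ_k w_k μ_k μ_kᵀ)A]) for full-column-rank matrices A. If A₁ ∈ ℝ^{d×r₁} and A₂ ∈ ℝ^{d×r₂} both have full column rank and the column space of A₁ is contained in the column space of A₂, then J(A₁) ≤ J(A₂). -/
open Matrix Real

noncomputable section

/-- Fisher discriminant `J(A) = Tr([AᵀΣA]⁻¹ [Aᵀ(∑_k w_k μ_k μ_kᵀ)A])`. -/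
def fisherDiscriminant {d K r : ℕ} (w : Fin K → ℝ) (μ : Fin K → Fin d → ℝ)
    (S : Matrix (Fin d) (Fin d) ℝ) (A : Matrix (Fin d) (Fin r) ℝ) : ℝ :=
  ((Aᵀ * S * A)⁻¹ * (Aᵀ * (∑ k, w k • vecMulVec (μ k) (μ k)) * A)).trace

end

/-- The matrix `A (AᵀΣA)⁻¹ Aᵀ`; times `Σ`, it is the `Σ`-orthogonal projection onto the column
space of `A`. -/
noncomputable def discriminantForm {d r : ℕ} (S : Matrix (Fin d) (Fin d) ℝ)
    (A : Matrix (Fin d) (Fin r) ℝ) : Matrix (Fin d) (Fin d) ℝ :=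
  A * (Aᵀ * S * A)⁻¹ * Aᵀ

theorem fisherDiscriminant_eq_sum {d K r : ℕ} (w : Fin K → ℝ) (μ : Fin K → Fin d → ℝ)
    (S : Matrix (Fin d) (Fin d) ℝ) (A : Matrix (Fin d) (Fin r) ℝ) :
    fisherDiscriminant w μ S A = ∑ k, w k * (discriminantForm S A *ᵥ μ k ⬝ᵥ μ k) := by
  rw [fisherDiscriminant, ← Matrix.mul_assoc, Matrix.trace_mul_comm, ← Matrix.mul_assoc,
    ← Matrix.mul_assoc, ← discriminantForm, Matrix.mul_sum, Matrix.trace_sum]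
  simp [Matrix.mul_vecMulVec, Matrix.trace_vecMulVec]

theorem discriminantForm_mulVec_mem_range {d r : ℕ} (S : Matrix (Fin d) (Fin d) ℝ)
    (A : Matrix (Fin d) (Fin r) ℝ) (m : Fin d → ℝ) :
    discriminantForm S A *ᵥ m ∈ LinearMap.range A.mulVecLin :=
  ⟨((Aᵀ * S * A)⁻¹ * Aᵀ) *ᵥ m, by simp [discriminantForm, Matrix.mul_assoc]⟩

theorem dotProduct_mulVec_discriminantForm {d r : ℕ} {S : Matrix (Fin d) (Fin d) ℝ}
    (hS : S.PosDef) {A : Matrix (Fin d) (Fin r) ℝ} (hA : Function.Injective A.mulVecLin)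
    (m : Fin d → ℝ) {v : Fin d → ℝ} (hv : v ∈ LinearMap.range A.mulVecLin) :
    v ⬝ᵥ S *ᵥ (discriminantForm S A *ᵥ m) = v ⬝ᵥ m := by
  obtain ⟨u, rfl⟩ := hv
  have hM : (Aᵀ * S * A).PosDef := by
    simpa using hS.conjTranspose_mul_mul_same hA
  have hdet : IsUnit (Aᵀ * S * A).det := (Matrix.isUnit_iff_isUnit_det _).1 hM.isUnit
  have key : Aᵀ * (S * discriminantForm S A) = Aᵀ := by
    have := Matrix.mul_nonsing_inv_cancel_left (Aᵀ * S * A) Aᵀ hdet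
    simpa only [discriminantForm, Matrix.mul_assoc] using this
  have hu (y : Fin d → ℝ) : A.mulVecLin u ⬝ᵥ y = u ⬝ᵥ Aᵀ *ᵥ y := by
    rw [Matrix.mulVecLin_apply, Matrix.dotProduct_mulVec, Matrix.vecMul_transpose]
  rw [hu, hu, Matrix.mulVec_mulVec, Matrix.mulVec_mulVec, Matrix.mul_assoc, key]

theorem discriminantForm_mono {d r₁ r₂ : ℕ} {S : Matrix (Fin d) (Fin d) ℝ} (hS : S.PosDef)
    {A₁ : Matrix (Fin d) (Fin r₁) ℝ} {A₂ : Matrix (Fin d) (Fin r₂) ℝ}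
    (h₁ : Function.Injective A₁.mulVecLin) (h₂ : Function.Injective A₂.mulVecLin)
    (hle : LinearMap.range A₁.mulVecLin ≤ LinearMap.range A₂.mulVecLin) (m : Fin d → ℝ) :
    discriminantForm S A₁ *ᵥ m ⬝ᵥ m ≤ discriminantForm S A₂ *ᵥ m ⬝ᵥ m := by
  have hx := discriminantForm_mulVec_mem_range S A₁ m
  have hy := discriminantForm_mulVec_mem_range S A₂ m
  have hxx := dotProduct_mulVec_discriminantForm hS h₁ m hx
  have hxy := dotProduct_mulVec_discriminantForm hS h₂ m (hle hx)
  have hyy := dotProduct_mulVec_discriminantForm hS h₂ m hy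
  set x := discriminantForm S A₁ *ᵥ m
  set y := discriminantForm S A₂ *ᵥ m
  have hsymm : y ⬝ᵥ S *ᵥ x = x ⬝ᵥ S *ᵥ y := by
    have hT : Sᵀ = S := by simpa using hS.isHermitian.eq
    rw [Matrix.dotProduct_mulVec, ← Matrix.mulVec_transpose, hT, dotProduct_comm]
  have hnonneg : 0 ≤ (y - x) ⬝ᵥ S *ᵥ (y - x) := by
    simpa using hS.posSemidef.dotProduct_mulVec_nonneg (y - x)
  rw [Matrix.mulVec_sub, sub_dotProduct, dotProduct_sub, dotProduct_sub] at hnonneg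
  linarith

/-- The Fisher discriminant is monotone with respect to inclusion of column
spaces of full-column-rank matrices. -/
theorem fisherDiscriminant_mono
    {d K r₁ r₂ : ℕ}
    (w : Fin K → ℝ) (μ : Fin K → Fin d → ℝ) (S : Matrix (Fin d) (Fin d) ℝ)
    (hw : ∀ k, 0 < w k) (hw1 : ∑ k, w k = 1) (hS : S.PosDef)
    (A₁ : Matrix (Fin d) (Fin r₁) ℝ) (A₂ : Matrix (Fin d) (Fin r₂) ℝ)
    (h₁ : Function.Injective A₁.mulVecLin) (h₂ : Function.Injective A₂.mulVecLin)
    (hle : LinearMap.range A₁.mulVecLin ≤ LinearMap.range A₂.mulVecLin) :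
    fisherDiscriminant w μ S A₁ ≤ fisherDiscriminant w μ S A₂ := by
  rw [fisherDiscriminant_eq_sum, fisherDiscriminant_eq_sum]
  exact Finset.sum_le_sum fun k _ =>
    mul_le_mul_of_nonneg_left (discriminantForm_mono hS h₁ h₂ hle (μ k)) (hw k).le
end
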